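/- arXiv:2604.13276 — 2 statements merged into one kernel-verified Lean document; each statement's English description precedes it below -/
import Mathlib

section
/- Unbiased estimating equations (observable form of Theorem 1). Let (Ω, F, μ) be a probability space, let m_Z ≤ F be a sub-σ-algebra, let d be a positive integer and β* ∈ ℝ^d, and let S be a finite index set. For each s ∈ S suppose: (i) m_s is a sub-σ-algebra with m_Z ≤ m_s ≤ F; (ii) V_s : Ω → (Fin d → ℝ) is m_s-measurable and almost surely bounded in norm by a constant C; (iii) ε_s : Ω → ℝ is integrable with conditional expectation μ[ε_s | m_s] = 0 almost everywhere; and (iv) Y_s := ⟪β*, V_s⟫ + ε_s, where ⟪·,·⟫ is the Euclidean inner product. Then for every coordinate k ∈ Fin d, the conditional expectation given m_Z of the random variable ω ↦ ∑_{s ∈ S} (Y_s(ω) − ⟪β*, V_s(ω)⟫) · (V_s(ω))_k is equal to 0 almost everywhere; that is, the estimating function U(β*) = ∑_{s ∈ S} (Y_s − ⟪β*, V_s⟫) • V_s satisfies μ[U(β*) | m_Z] = 0 almost everywhere, coordinatewise. -/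
open MeasureTheory ProbabilityTheory Filter Matrix

/-- Unbiased estimating equations (observable form of Theorem 1): each term of the
least-squares estimating function has conditional mean zero given the centre
characteristics σ-algebra `mZ`. -/
theorem unbiased_estimating_equations
    {Ω ι : Type*} {F : MeasurableSpace Ω} {μ : Measure Ω} [IsProbabilityMeasure μ]
    (mZ : MeasurableSpace Ω) (hmZ : mZ ≤ F)
    (d : ℕ) (hd : 0 < d) (βstar : Fin d → ℝ) (S : Finset ι)
    (m : ι → MeasurableSpace Ω)
    (hmZle : ∀ s ∈ S, mZ ≤ m s) (hmleF : ∀ s ∈ S, m s ≤ F)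
    (V : ι → Ω → Fin d → ℝ) (hVmeas : ∀ s ∈ S, Measurable[m s] (V s))
    (C : ℝ) (hVbd : ∀ s ∈ S, ∀ᵐ ω ∂μ, ‖V s ω‖ ≤ C)
    (ε : ι → Ω → ℝ) (hεint : ∀ s ∈ S, Integrable (ε s) μ)
    (hεcond : ∀ s ∈ S, μ[ε s | m s] =ᵐ[μ] 0)
    (Y : ι → Ω → ℝ) (hY : ∀ s ∈ S, ∀ ω, Y s ω = βstar ⬝ᵥ V s ω + ε s ω) :
    ∀ k : Fin d,
      μ[fun ω => ∑ s ∈ S, (Y s ω - βstar ⬝ᵥ V s ω) * V s ω k | mZ] =ᵐ[μ] 0 := by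
  intro k
  have hfun : (fun ω => ∑ s ∈ S, (Y s ω - βstar ⬝ᵥ V s ω) * V s ω k)
      = ∑ s ∈ S, ((fun ω => V s ω k) * ε s) := by
    funext ω
    rw [Finset.sum_apply]
    refine Finset.sum_congr rfl fun s hs => ?_
    rw [hY s hs ω, Pi.mul_apply]
    ring
  have hsm : ∀ s ∈ S, StronglyMeasurable[m s] (fun ω => V s ω k) := fun s hs =>
    ((measurable_pi_apply k).comp (hVmeas s hs)).stronglyMeasurable
  have hbd : ∀ s ∈ S, ∀ᵐ ω ∂μ, ‖V s ω k‖ ≤ C := fun s hs => by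
    filter_upwards [hVbd s hs] with ω hω
    exact (norm_le_pi_norm (V s ω) k).trans hω
  have hint : ∀ s ∈ S, Integrable ((fun ω => V s ω k) * ε s) μ := fun s hs =>
    (hεint s hs).bdd_mul ((hsm s hs).mono (hmleF s hs)).aestronglyMeasurable (hbd s hs)
  have hterm : ∀ s ∈ S, μ[(fun ω => V s ω k) * ε s | mZ] =ᵐ[μ] 0 := fun s hs => by
    have h1 : μ[(fun ω => V s ω k) * ε s | m s] =ᵐ[μ] 0 := by
      filter_upwards [condExp_stronglyMeasurable_mul_of_bound (hmleF s hs) (hsm s hs)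
        (hεint s hs) C (hbd s hs), hεcond s hs] with ω h h0
      rw [h, Pi.mul_apply, h0]
      simp
    have h2 := condExp_congr_ae (m := mZ) h1
    rw [condExp_zero] at h2
    exact (condExp_condExp_of_le (hmZle s hs) (hmleF s hs)).symm.trans h2
  rw [hfun]
  refine (condExp_finsetSum hint mZ).trans ?_
  have hall : ∀ᵐ ω ∂μ, ∀ s ∈ S, (μ[(fun ω => V s ω k) * ε s | mZ]) ω = 0 :=
    (Finset.eventually_all S).2 hterm
  filter_upwards [hall] with ω hω
  rw [Finset.sum_apply]
  exact Finset.sum_eq_zero hω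
end

section
/- Consistency mechanism for linear estimating equations (core of Theorem 2). Let (Ω, F, μ) be a probability space, d a positive integer, β* ∈ (Fin d → ℝ), and M ∈ Matrix (Fin d) (Fin d) ℝ an invertible matrix. For each n ∈ ℕ let M_n : Ω → Matrix (Fin d) (Fin d) ℝ be measurable with every entry of M_n converging in probability to the corresponding entry of M; let V_n : Ω → (Fin d → ℝ) be measurable with every coordinate converging in probability to 0; and let β̂_n : Ω → (Fin d → ℝ) be measurable such that for almost every ω, (M_n ω).mulVec (β̂_n ω − β*) = V_n ω. Then β̂_n converges in probability to the constant β*: for every δ > 0, μ{ω : ‖β̂_n(ω) − β*‖ ≥ δ} → 0 as n → ∞. -/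
open MeasureTheory ProbabilityTheory Filter Matrix

theorem linear_solution_small {d : ℕ} (M : Matrix (Fin d) (Fin d) ℝ) (hM : IsUnit M)
    {δ : ℝ} (hδ : 0 < δ) : ∃ ε > 0, ∀ (A : Matrix (Fin d) (Fin d) ℝ) (v x : Fin d → ℝ),
      (∀ k l, dist (A k l) (M k l) < ε) → (∀ k, dist (v k) 0 < ε) →
      A.mulVec x = v → dist x 0 < δ := by
  have hdet : M.det ≠ 0 := ((Matrix.isUnit_iff_isUnit_det M).1 hM).ne_zero
  let f : (Fin d → Fin d → ℝ) × (Fin d → ℝ) → (Fin d → ℝ) := fun p =>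
    ((Matrix.of p.1).det)⁻¹ • ((Matrix.of p.1).adjugate.mulVec p.2)
  have hof : Continuous (fun p : (Fin d → Fin d → ℝ) × (Fin d → ℝ) => Matrix.of p.1) :=
    continuous_fst
  let p₀ : (Fin d → Fin d → ℝ) × (Fin d → ℝ) := (fun k l => M k l, 0)
  have hd0 : (Matrix.of p₀.1).det ≠ 0 := hdet
  have hf : ContinuousAt f p₀ :=
    (hof.matrix_det.continuousAt.inv₀ hd0).smul
      (hof.matrix_adjugate.matrix_mulVec continuous_snd).continuousAt
  have hf0 : f p₀ = 0 := by simp [f, p₀]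
  have h1 : ∀ᶠ p in nhds p₀, dist (f p) 0 < δ := by
    have := Metric.tendsto_nhds.1 hf δ hδ
    rwa [hf0] at this
  have h2 : ∀ᶠ p in nhds p₀, (Matrix.of p.1).det ≠ 0 :=
    hof.matrix_det.continuousAt.eventually_ne hd0
  obtain ⟨ε, hε, h⟩ := Metric.eventually_nhds_iff.1 (h1.and h2)
  refine ⟨ε, hε, fun A v x hA hv hx => ?_⟩
  have hp : dist ((fun k l => A k l, v) : (Fin d → Fin d → ℝ) × (Fin d → ℝ)) p₀ < ε := by
    rw [Prod.dist_eq, max_lt_iff]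
    exact ⟨(dist_pi_lt_iff hε).2 fun k => (dist_pi_lt_iff hε).2 fun l => hA k l,
      (dist_pi_lt_iff hε).2 fun k => hv k⟩
  obtain ⟨h3, h4⟩ := h hp
  have hA0 : A.det ≠ 0 := h4
  have : f (fun k l => A k l, v) = x := by
    change (A.det)⁻¹ • (A.adjugate.mulVec v) = x
    rw [← hx, Matrix.mulVec_mulVec, Matrix.adjugate_mul, Matrix.smul_mulVec, Matrix.one_mulVec,
      smul_smul, inv_mul_cancel₀ hA0, one_smul]
  rwa [this] at h3

/-- Consistency mechanism for linear estimating equations (core of Theorem 2):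
if random matrices `M_n` converge entrywise in probability to an invertible matrix
`M`, random vectors `V_n` converge coordinatewise in probability to 0, and almost
surely `M_n (β̂_n − β*) = V_n`, then `β̂_n` converges in probability to `β*`. -/
theorem linear_estimating_consistency
    {Ω : Type*} {F : MeasurableSpace Ω} (μ : Measure Ω) [IsProbabilityMeasure μ]
    (d : ℕ) (hd : 0 < d) (βstar : Fin d → ℝ)
    (M : Matrix (Fin d) (Fin d) ℝ) (hM : IsUnit M)
    (Mn : ℕ → Ω → Matrix (Fin d) (Fin d) ℝ)
    (hMnmeas : ∀ n k l, Measurable (fun ω => Mn n ω k l))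
    (hMnconv : ∀ k l, TendstoInMeasure μ (fun n ω => Mn n ω k l) atTop
      fun _ => M k l)
    (V : ℕ → Ω → Fin d → ℝ)
    (hVmeas : ∀ n k, Measurable (fun ω => V n ω k))
    (hVconv : ∀ k, TendstoInMeasure μ (fun n ω => V n ω k) atTop fun _ => 0)
    (βhat : ℕ → Ω → Fin d → ℝ) (hβmeas : ∀ n, Measurable (βhat n))
    (heq : ∀ n, ∀ᵐ ω ∂μ, (Mn n ω).mulVec (βhat n ω - βstar) = V n ω) :
    TendstoInMeasure μ βhat atTop fun _ => βstar := by
  rw [tendstoInMeasure_iff_dist]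
  intro δ hδ
  obtain ⟨ε, hε, h⟩ := linear_solution_small M hM hδ
  have hA : Tendsto (fun n => (∑ k, ∑ l, μ {ω | ε ≤ dist (Mn n ω k l) (M k l)}) +
      ∑ k, μ {ω | ε ≤ dist (V n ω k) 0}) atTop (nhds 0) := by
    have h1 := tendsto_finsetSum (Finset.univ : Finset (Fin d)) fun k _ =>
      tendsto_finsetSum (Finset.univ : Finset (Fin d)) fun l _ =>
        tendstoInMeasure_iff_dist.1 (hMnconv k l) ε hε
    have h2 := tendsto_finsetSum (Finset.univ : Finset (Fin d)) fun k _ =>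
        tendstoInMeasure_iff_dist.1 (hVconv k) ε hε
    simpa using h1.add h2
  refine tendsto_of_tendsto_of_tendsto_of_le_of_le tendsto_const_nhds hA
    (fun _ => zero_le) fun n => ?_
  have hsub : μ {ω | δ ≤ dist (βhat n ω) βstar} ≤
      μ ((⋃ k, ⋃ l, {ω | ε ≤ dist (Mn n ω k l) (M k l)}) ∪
        ⋃ k, {ω | ε ≤ dist (V n ω k) 0}) := by
    apply measure_mono_ae
    filter_upwards [heq n] with ω hω hδω
    by_contra hcon
    have hcon' : ¬ (ω ∈ ((⋃ k, ⋃ l, {ω | ε ≤ dist (Mn n ω k l) (M k l)}) ∪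
        ⋃ k, {ω | ε ≤ dist (V n ω k) 0})) := hcon
    simp only [Set.mem_union, Set.mem_iUnion, Set.mem_setOf_eq, not_or, not_exists,
      not_le] at hcon'
    have h5 := h _ _ _ hcon'.1 hcon'.2 hω
    have h6 : δ ≤ dist (βhat n ω) βstar := hδω
    rw [dist_zero_right, ← dist_eq_norm] at h5
    exact absurd h5 (not_lt.2 h6)
  refine hsub.trans ((measure_union_le _ _).trans (add_le_add ?_ ?_))
  · exact (measure_iUnion_fintype_le _ _).trans
      (Finset.sum_le_sum fun k _ => measure_iUnion_fintype_le _ _)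
  · exact measure_iUnion_fintype_le _ _
end
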